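/- (Existence of harmonic extensions; flat-model version of the paper's Proposition 'harm', quoted from Graham–Jenne–Mason–Sparling.) Let k ≥ 1 be an integer and let f be a smooth function on ℝ^N ∖ {0} homogeneous of weight k − n/2. Then there exists a smooth function f̃ on ℝ^N ∖ {0}, homogeneous of weight k − n/2, such that f̃ − f is O(Q) and Δ f̃ is O(Q^{k−1}). -/

import Mathlib

open scoped BigOperators

/-- Partial derivative in the `A`-th coordinate direction. -/
noncomputable def pd {N : ℕ} (A : Fin N) (f : (Fin N → ℝ) → ℝ) : (Fin N → ℝ) → ℝ :=
  fun x => fderiv ℝ f x (Pi.single A 1)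

/-- Ambient Laplacian `Δf = ∑_{A,B} h^{AB} ∂_A ∂_B f` w.r.t. the inverse metric `hInv`. -/
noncomputable def lap {N : ℕ} (hInv : Matrix (Fin N) (Fin N) ℝ)
    (f : (Fin N → ℝ) → ℝ) : (Fin N → ℝ) → ℝ :=
  fun x => ∑ A : Fin N, ∑ B : Fin N, hInv A B * pd A (pd B f) x

/-- `X_A(x) = ∑_B h_{AB} x^B`. -/
def Xc {N : ℕ} (h : Matrix (Fin N) (Fin N) ℝ) (A : Fin N) : (Fin N → ℝ) → ℝ :=
  fun x => ∑ B : Fin N, h A B * x B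

/-- `Q(x) = ∑_{A,B} h_{AB} x^A x^B`. -/
def Qfun {N : ℕ} (h : Matrix (Fin N) (Fin N) ℝ) : (Fin N → ℝ) → ℝ :=
  fun x => ∑ A : Fin N, ∑ B : Fin N, h A B * x A * x B

/-- Smooth (C^∞) on `ℝ^N ∖ {0}`. -/
def SmoothOffZero {N : ℕ} (f : (Fin N → ℝ) → ℝ) : Prop :=
  ContDiffOn ℝ (⊤ : ℕ∞) f {x : Fin N → ℝ | x ≠ 0}

/-- Homogeneous of weight `w` on `ℝ^N ∖ {0}`. -/
def Homog {N : ℕ} (w : ℝ) (f : (Fin N → ℝ) → ℝ) : Prop :=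
  ∀ x : Fin N → ℝ, x ≠ 0 → (∑ A : Fin N, x A * pd A f x) = w * f x

/-- Ambient tractor-D operator at weight `w`: `(D^{(w)} f)_A = (n+2w−2)∂_A f − X_A Δf`. -/
noncomputable def Dop {N : ℕ} (n : ℕ) (h hInv : Matrix (Fin N) (Fin N) ℝ) (w : ℝ)
    (f : (Fin N → ℝ) → ℝ) (A : Fin N) : (Fin N → ℝ) → ℝ :=
  fun x => ((n : ℝ) + 2 * w - 2) * pd A f x - Xc h A x * lap hInv f x

/-- Iterated tractor-D: `seqD … w0 f A 0 = f` and
`seqD … w0 f A (j+1) = (D^{(w0−j)} (seqD … w0 f A j))_{A (j+1)}`. -/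
noncomputable def seqD {N : ℕ} (n : ℕ) (h hInv : Matrix (Fin N) (Fin N) ℝ)
    (w0 : ℝ) (f : (Fin N → ℝ) → ℝ) (A : ℕ → Fin N) : ℕ → (Fin N → ℝ) → ℝ
  | 0 => f
  | j + 1 => Dop n h hInv (w0 - (j : ℝ)) (seqD n h hInv w0 f A j) (A (j + 1))

/-- `u` is `O(Q^m)`: `u = Q^m · g` for some smooth `g` on `ℝ^N ∖ {0}`. -/
def BigOQ {N : ℕ} (h : Matrix (Fin N) (Fin N) ℝ) (m : ℕ) (u : (Fin N → ℝ) → ℝ) : Prop :=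
  ∃ g : (Fin N → ℝ) → ℝ, SmoothOffZero g ∧
    ∀ x : Fin N → ℝ, x ≠ 0 → u x = (Qfun h x) ^ m * g x

theorem isOpen_ne_zero {N : ℕ} : IsOpen {x : Fin N → ℝ | x ≠ 0} := isOpen_ne

namespace SmoothOffZero

variable {N : ℕ} {f g : (Fin N → ℝ) → ℝ} {x : Fin N → ℝ}

theorem differentiableAt (hf : SmoothOffZero f) (hx : x ≠ 0) : DifferentiableAt ℝ f x :=
  (ContDiffOn.contDiffAt hf (isOpen_ne_zero.mem_nhds hx)).differentiableAt (by simp)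

theorem pd (hf : SmoothOffZero f) (A : Fin N) : SmoothOffZero (pd A f) :=
  (ContDiffOn.fderiv_of_isOpen hf isOpen_ne_zero (by simp)).clm_apply contDiffOn_const

theorem add (hf : SmoothOffZero f) (hg : SmoothOffZero g) :
    SmoothOffZero (fun y => f y + g y) :=
  ContDiffOn.add hf hg

theorem mul (hf : SmoothOffZero f) (hg : SmoothOffZero g) :
    SmoothOffZero (fun y => f y * g y) :=
  ContDiffOn.mul hf hg

theorem pow (hf : SmoothOffZero f) (m : ℕ) : SmoothOffZero (fun y => f y ^ m) :=
  ContDiffOn.pow hf m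

theorem const (c : ℝ) : SmoothOffZero (fun _ : Fin N → ℝ => c) :=
  contDiffOn_const

theorem sum {ι : Type*} {s : Finset ι} {F : ι → (Fin N → ℝ) → ℝ}
    (hF : ∀ i ∈ s, SmoothOffZero (F i)) : SmoothOffZero (fun y => ∑ i ∈ s, F i y) :=
  ContDiffOn.sum hF

theorem lap (hf : SmoothOffZero f) (hInv : Matrix (Fin N) (Fin N) ℝ) :
    SmoothOffZero (lap hInv f) :=
  sum fun A _ => sum fun B _ => (const _).mul ((hf.pd B).pd A)

end SmoothOffZero

theorem smoothOffZero_coord {N : ℕ} (A : Fin N) : SmoothOffZero (fun y : Fin N → ℝ => y A) :=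
  (contDiff_apply ℝ ℝ A).contDiffOn

theorem smoothOffZero_Qfun {N : ℕ} (h : Matrix (Fin N) (Fin N) ℝ) : SmoothOffZero (Qfun h) :=
  .sum fun A _ => .sum fun B _ =>
    ((SmoothOffZero.const _).mul (smoothOffZero_coord A)).mul (smoothOffZero_coord B)

section PartialDerivatives

variable {N : ℕ} {f g : (Fin N → ℝ) → ℝ} {x : Fin N → ℝ}

theorem pd_congr (hfg : ∀ y, y ≠ 0 → f y = g y) (hx : x ≠ 0) (A : Fin N) :
    pd A f x = pd A g x := by
  have : f =ᶠ[nhds x] g :=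
    Filter.eventually_of_mem (isOpen_ne_zero.mem_nhds hx) hfg
  simp only [pd, this.fderiv_eq]

theorem pd_add (hf : DifferentiableAt ℝ f x) (hg : DifferentiableAt ℝ g x) (A : Fin N) :
    pd A (fun y => f y + g y) x = pd A f x + pd A g x := by
  simp only [pd, fderiv_fun_add hf hg, add_apply]

theorem pd_mul (hf : DifferentiableAt ℝ f x) (hg : DifferentiableAt ℝ g x) (A : Fin N) :
    pd A (fun y => f y * g y) x = pd A f x * g x + f x * pd A g x := by
  simp only [pd, fderiv_fun_mul hf hg, add_apply, smul_apply, smul_eq_mul]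
  ring

theorem pd_sum {ι : Type*} {s : Finset ι} {F : ι → (Fin N → ℝ) → ℝ}
    (hF : ∀ i ∈ s, DifferentiableAt ℝ (F i) x) (A : Fin N) :
    pd A (fun y => ∑ i ∈ s, F i y) x = ∑ i ∈ s, pd A (F i) x := by
  simp only [pd, fderiv_fun_sum hF, sum_apply]

theorem pd_const (c : ℝ) (A : Fin N) : pd A (fun _ => c) x = 0 := by
  simp [pd]

theorem pd_coord (A B : Fin N) : pd A (fun y => y B) x = if A = B then 1 else 0 := by
  have : fderiv ℝ (fun y : Fin N → ℝ => y B) x = ContinuousLinearMap.proj B :=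
    (ContinuousLinearMap.proj (R := ℝ) (φ := fun _ : Fin N => ℝ) B).fderiv
  simp [pd, this, Pi.single_apply, eq_comm]

theorem pd_comm (hf : SmoothOffZero f) (hx : x ≠ 0) (A B : Fin N) :
    pd A (pd B f) x = pd B (pd A f) x := by
  have hcd : ContDiffAt ℝ (⊤ : ℕ∞) f x := ContDiffOn.contDiffAt hf (isOpen_ne_zero.mem_nhds hx)
  have hd : DifferentiableAt ℝ (fderiv ℝ f) x :=
    (hcd.fderiv_right (m := (⊤ : ℕ∞)) (by simp)).differentiableAt (by simp)
  have key (C D : Fin N) : pd C (pd D f) x =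
      fderiv ℝ (fderiv ℝ f) x (Pi.single C 1) (Pi.single D 1) := by
    unfold pd
    rw [fderiv_clm_apply hd (differentiableAt_const _)]
    simp
  rw [key, key]
  exact hcd.isSymmSndFDerivAt
    (by simpa using WithTop.coe_le_coe.2 (le_top : (2 : ℕ∞) ≤ ⊤)) _ _

theorem pd_pd_add (hf : SmoothOffZero f) (hg : SmoothOffZero g) (hx : x ≠ 0) (A B : Fin N) :
    pd A (pd B (fun y => f y + g y)) x = pd A (pd B f) x + pd A (pd B g) x := by
  rw [pd_congr (fun y hy => pd_add (hf.differentiableAt hy) (hg.differentiableAt hy) B) hx,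
    pd_add ((hf.pd B).differentiableAt hx) ((hg.pd B).differentiableAt hx)]

theorem pd_pd_mul (hf : SmoothOffZero f) (hg : SmoothOffZero g) (hx : x ≠ 0) (A B : Fin N) :
    pd A (pd B (fun y => f y * g y)) x =
      pd A (pd B f) x * g x + pd B f x * pd A g x + pd A f x * pd B g x
        + f x * pd A (pd B g) x := by
  rw [pd_congr (fun y hy => pd_mul (hf.differentiableAt hy) (hg.differentiableAt hy) B) hx,
    pd_add (((hf.pd B).mul hg).differentiableAt hx) ((hf.mul (hg.pd B)).differentiableAt hx),
    pd_mul ((hf.pd B).differentiableAt hx) (hg.differentiableAt hx),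
    pd_mul (hf.differentiableAt hx) ((hg.pd B).differentiableAt hx)]
  ring

theorem lap_add (hInv : Matrix (Fin N) (Fin N) ℝ) (hf : SmoothOffZero f) (hg : SmoothOffZero g)
    (hx : x ≠ 0) : lap hInv (fun y => f y + g y) x = lap hInv f x + lap hInv g x := by
  simp only [lap, pd_pd_add hf hg hx, mul_add, Finset.sum_add_distrib]

theorem lap_mul (hInv : Matrix (Fin N) (Fin N) ℝ) (hf : SmoothOffZero f) (hg : SmoothOffZero g)
    (hx : x ≠ 0) :
    lap hInv (fun y => f y * g y) x = lap hInv f x * g x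
      + ∑ A, ∑ B, hInv A B * (pd B f x * pd A g x) + ∑ A, ∑ B, hInv A B * (pd A f x * pd B g x)
      + f x * lap hInv g x := by
  simp only [lap, pd_pd_mul hf hg hx, mul_add, Finset.sum_add_distrib, Finset.sum_mul,
    Finset.mul_sum, mul_assoc, mul_left_comm]

theorem lap_const_mul (hInv : Matrix (Fin N) (Fin N) ℝ) (c : ℝ) (hf : SmoothOffZero f)
    (hx : x ≠ 0) : lap hInv (fun y => c * f y) x = c * lap hInv f x := by
  rw [lap_mul hInv (.const c) hf hx]
  have hc : ∀ A : Fin N, pd A (fun _ : Fin N → ℝ => c) = fun _ => 0 :=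
    fun A => funext fun _ => pd_const c A
  simp [lap, hc, pd_const]

end PartialDerivatives

namespace Homog

variable {N : ℕ} {f g : (Fin N → ℝ) → ℝ} {w v : ℝ}

theorem add (hf : SmoothOffZero f) (hg : SmoothOffZero g) (hfw : Homog w f) (hgw : Homog w g) :
    Homog w (fun y => f y + g y) := by
  intro x hx
  simp only [pd_add (hf.differentiableAt hx) (hg.differentiableAt hx), mul_add,
    Finset.sum_add_distrib, hfw x hx, hgw x hx]

theorem mul (hf : SmoothOffZero f) (hg : SmoothOffZero g) (hfw : Homog w f) (hgv : Homog v g) :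
    Homog (w + v) (fun y => f y * g y) := by
  intro x hx
  simp only [pd_mul (hf.differentiableAt hx) (hg.differentiableAt hx), mul_add,
    Finset.sum_add_distrib]
  have h1 : ∑ A, x A * (pd A f x * g x) = (∑ A, x A * pd A f x) * g x := by
    simp only [Finset.sum_mul, mul_assoc]
  have h2 : ∑ A, x A * (f x * pd A g x) = f x * ∑ A, x A * pd A g x := by
    simp only [Finset.mul_sum, mul_left_comm]
  rw [h1, h2, hfw x hx, hgv x hx]
  ring

theorem const (c : ℝ) : Homog 0 (fun _ : Fin N → ℝ => c) := by
  intro x _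
  simp [pd_const]

theorem const_mul (hf : SmoothOffZero f) (c : ℝ) (hfw : Homog w f) :
    Homog w (fun y => c * f y) := by
  simpa using (const c).mul (.const c) hf hfw

theorem pow (hf : SmoothOffZero f) (hfw : Homog w f) (m : ℕ) :
    Homog (m * w) (fun y => f y ^ m) := by
  induction m with
  | zero => simpa using const (N := N) 1
  | succ m ih =>
    simp only [pow_succ, Nat.cast_succ, add_mul, one_mul]
    exact ih.mul (hf.pow m) hf hfw

theorem sum {ι : Type*} {s : Finset ι} {F : ι → (Fin N → ℝ) → ℝ}
    (hF : ∀ i ∈ s, SmoothOffZero (F i)) (hw : ∀ i ∈ s, Homog w (F i)) :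
    Homog w (fun y => ∑ i ∈ s, F i y) := by
  intro x hx
  simp only [pd_sum fun i hi => (hF i hi).differentiableAt hx, Finset.mul_sum]
  rw [Finset.sum_comm]
  exact Finset.sum_congr rfl fun i hi => hw i hi x hx

theorem pd (hf : SmoothOffZero f) (hfw : Homog w f) (B : Fin N) : Homog (w - 1) (pd B f) := by
  intro x hx
  have key := pd_congr hfw hx B
  rw [pd_sum (fun A _ => ((smoothOffZero_coord A).mul (hf.pd A)).differentiableAt hx),
    pd_mul (differentiableAt_const w) (hf.differentiableAt hx), pd_const] at key
  simp only [pd_mul ((smoothOffZero_coord _).differentiableAt hx)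
    ((hf.pd _).differentiableAt hx), pd_coord, Finset.sum_add_distrib, ite_mul, one_mul, zero_mul,
    Finset.sum_ite_eq, Finset.mem_univ, if_true, pd_comm hf hx B] at key
  linarith

theorem lap (hf : SmoothOffZero f) (hfw : Homog w f) (hInv : Matrix (Fin N) (Fin N) ℝ) :
    Homog (w - 2) (lap hInv f) := by
  have hw : w - 2 = w - 1 - 1 := by ring
  rw [hw]
  exact sum (fun A _ => .sum fun B _ => (SmoothOffZero.const _).mul ((hf.pd B).pd A)) fun A _ =>
    sum (fun B _ => (SmoothOffZero.const _).mul ((hf.pd B).pd A)) fun B _ =>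
      ((hfw.pd hf B).pd (hf.pd B) A).const_mul ((hf.pd B).pd A) _

end Homog

theorem homog_coord {N : ℕ} (A : Fin N) : Homog 1 (fun y : Fin N → ℝ => y A) := by
  intro x _
  simp [pd_coord]

theorem homog_Qfun {N : ℕ} (h : Matrix (Fin N) (Fin N) ℝ) : Homog 2 (Qfun h) := by
  have hs (A B : Fin N) : SmoothOffZero (fun y : Fin N → ℝ => h A B * y A * y B) :=
    ((SmoothOffZero.const _).mul (smoothOffZero_coord A)).mul (smoothOffZero_coord B)
  refine Homog.sum (fun A _ => .sum fun B _ => hs A B) fun A _ =>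
    Homog.sum (fun B _ => hs A B) fun B _ => ?_
  convert ((homog_coord A).const_mul (smoothOffZero_coord A) (h A B)).mul
    ((SmoothOffZero.const _).mul (smoothOffZero_coord A)) (smoothOffZero_coord B)
    (homog_coord B) using 1
  norm_num

section QuadraticForm

variable {N : ℕ} {h hInv : Matrix (Fin N) (Fin N) ℝ} {x : Fin N → ℝ}

theorem pd_Xc (hx : x ≠ 0) (A B : Fin N) : pd A (Xc h B) x = h B A := by
  unfold Xc
  rw [pd_sum fun C _ => ((SmoothOffZero.const _).mul (smoothOffZero_coord C)).differentiableAt hx]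
  simp [pd_mul (differentiableAt_const _) ((smoothOffZero_coord _).differentiableAt hx), pd_const,
    pd_coord]

theorem smoothOffZero_Xc (A : Fin N) : SmoothOffZero (Xc h A) :=
  .sum fun B _ => (SmoothOffZero.const _).mul (smoothOffZero_coord B)

theorem Qfun_eq_sum_Xc : Qfun h = fun y => ∑ A, y A * Xc h A y := by
  funext y
  simp only [Qfun, Xc, Finset.mul_sum]
  exact Finset.sum_congr rfl fun A _ => Finset.sum_congr rfl fun B _ => by ring

theorem pd_Qfun (hSymm : ∀ A B, h A B = h B A) (hx : x ≠ 0) (A : Fin N) :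
    pd A (Qfun h) x = 2 * Xc h A x := by
  rw [Qfun_eq_sum_Xc,
    pd_sum fun C _ => ((smoothOffZero_coord C).mul (smoothOffZero_Xc C)).differentiableAt hx]
  simp only [pd_mul ((smoothOffZero_coord _).differentiableAt hx)
    ((smoothOffZero_Xc _).differentiableAt hx), pd_coord, pd_Xc hx, Finset.sum_add_distrib,
    ite_mul, one_mul, zero_mul, Finset.sum_ite_eq, Finset.mem_univ, if_true]
  rw [two_mul]
  congr 1
  exact Finset.sum_congr rfl fun C _ => by rw [hSymm C A, mul_comm]

theorem sum_hInv_mul_Xc (hInvh : h * hInv = 1) (A : Fin N) :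
    ∑ B, hInv A B * Xc h B x = x A := by
  have : Matrix.mulVec hInv (Matrix.mulVec h x) = x := by
    rw [Matrix.mulVec_mulVec, mul_eq_one_comm.mp hInvh, Matrix.one_mulVec]
  exact congrFun this A

theorem sum_hInv_mul_Xc' (hSymm : ∀ A B, h A B = h B A) (hInvh : h * hInv = 1) (B : Fin N) :
    ∑ A, hInv A B * Xc h A x = x B := by
  refine sum_hInv_mul_Xc (hInv := hInv.transpose) ?_ B
  have hT : h.transpose = h := Matrix.ext fun A B => hSymm B A
  have := congrArg Matrix.transpose (mul_eq_one_comm.mp hInvh)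
  rwa [Matrix.transpose_mul, hT, Matrix.transpose_one] at this

theorem lap_Qfun (hSymm : ∀ A B, h A B = h B A) (hInvh : h * hInv = 1) (hx : x ≠ 0) :
    lap hInv (Qfun h) x = 2 * N := by
  have h2 (A B : Fin N) : pd A (pd B (Qfun h)) x = 2 * h B A := by
    rw [pd_congr (fun y hy => pd_Qfun hSymm hy B) hx,
      pd_mul (differentiableAt_const _) ((smoothOffZero_Xc B).differentiableAt hx), pd_const,
      pd_Xc hx]
    ring
  have htr : ∑ A, ∑ B, hInv A B * h B A = N := by
    have := congrArg Matrix.trace (mul_eq_one_comm.mp hInvh)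
    simpa [Matrix.trace, Matrix.mul_apply] using this
  simp only [lap, h2, mul_left_comm _ (2 : ℝ), ← Finset.mul_sum, htr]

theorem lap_Qfun_mul (hSymm : ∀ A B, h A B = h B A) (hInvh : h * hInv = 1)
    {u : (Fin N → ℝ) → ℝ} {v : ℝ} (hu : SmoothOffZero u) (huv : Homog v u) (hx : x ≠ 0) :
    lap hInv (fun y => Qfun h y * u y) x =
      Qfun h x * lap hInv u x + (2 * N + 4 * v) * u x := by
  have h1 : ∑ A, ∑ B, hInv A B * (2 * Xc h B x * pd A u x) = 2 * (v * u x) := by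
    rw [← huv x hx, Finset.mul_sum]
    refine Finset.sum_congr rfl fun A _ => ?_
    rw [← sum_hInv_mul_Xc (x := x) hInvh A, Finset.sum_mul, Finset.mul_sum]
    exact Finset.sum_congr rfl fun B _ => by ring
  have h2 : ∑ A, ∑ B, hInv A B * (2 * Xc h A x * pd B u x) = 2 * (v * u x) := by
    rw [← huv x hx, Finset.mul_sum, Finset.sum_comm]
    refine Finset.sum_congr rfl fun B _ => ?_
    rw [← sum_hInv_mul_Xc' (x := x) hSymm hInvh B, Finset.sum_mul, Finset.mul_sum]
    exact Finset.sum_congr rfl fun A _ => by ring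
  rw [lap_mul hInv (smoothOffZero_Qfun h) hu hx, lap_Qfun hSymm hInvh hx]
  simp only [pd_Qfun hSymm hx, h1, h2]
  ring

theorem lap_Qfun_pow_succ_mul (hSymm : ∀ A B, h A B = h B A) (hInvh : h * hInv = 1)
    {u : (Fin N → ℝ) → ℝ} {v : ℝ} (hu : SmoothOffZero u) (huv : Homog v u) (hx : x ≠ 0) (m : ℕ) :
    lap hInv (fun y => Qfun h y ^ (m + 1) * u y) x = Qfun h x ^ (m + 1) * lap hInv u x
      + (m + 1) * (2 * N + 4 * m + 4 * v) * (Qfun h x ^ m * u x) := by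
  induction m with
  | zero => simpa using lap_Qfun_mul hSymm hInvh hu huv hx
  | succ m ih =>
    have hQ := smoothOffZero_Qfun h
    have heq : (fun y => Qfun h y ^ (m + 1 + 1) * u y) =
        fun y => Qfun h y * (Qfun h y ^ (m + 1) * u y) := by
      funext y
      ring
    rw [heq, lap_Qfun_mul hSymm hInvh ((hQ.pow (m + 1)).mul hu)
      (((homog_Qfun h).pow hQ (m + 1)).mul (hQ.pow (m + 1)) hu huv) hx, ih]
    push_cast
    ring

end QuadraticForm

/-- The inductive form of the extension: the quotient `g` of `Δ f̃` by `Q ^ j` is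
homogeneous, which allows the next correction term to be a multiple of `Q ^ (j + 1) * g`. -/
theorem exists_extension_lap_eq_pow_mul {n k : ℕ} {h hInv : Matrix (Fin (n + 2)) (Fin (n + 2)) ℝ}
    (hSymm : ∀ A B, h A B = h B A) (hInvh : h * hInv = 1)
    {f : (Fin (n + 2) → ℝ) → ℝ} (hf : SmoothOffZero f)
    (hhom : Homog ((k : ℝ) - (n : ℝ) / 2) f) (j : ℕ) (hj : j < k) :
    ∃ ft g : (Fin (n + 2) → ℝ) → ℝ,
      SmoothOffZero ft ∧ Homog ((k : ℝ) - (n : ℝ) / 2) ft ∧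
      BigOQ h 1 (fun y => ft y - f y) ∧
      SmoothOffZero g ∧ Homog ((k : ℝ) - (n : ℝ) / 2 - 2 * (j + 1)) g ∧
      ∀ x, x ≠ 0 → lap hInv ft x = Qfun h x ^ j * g x := by
  induction j with
  | zero =>
    refine ⟨f, lap hInv f, hf, hhom, ⟨fun _ => 0, .const 0, by simp⟩, hf.lap hInv, ?_, by simp⟩
    simpa using hhom.lap hf hInv
  | succ j ih =>
    obtain ⟨ft, g, hft, hftw, ⟨e, he, hfe⟩, hg, hgw, hlap⟩ := ih (by omega)
    have hQ := smoothOffZero_Qfun h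
    obtain ⟨c, hc⟩ : ∃ c : ℝ, c * ((j + 1) * (4 * ((k : ℝ) - (j + 1)))) = -1 := by
      have hjk : (k : ℝ) - (j + 1) ≠ 0 := by
        have : ((j + 1 : ℕ) : ℝ) < k := by exact_mod_cast hj
        push_cast at this
        linarith
      have hj0 : (j : ℝ) + 1 ≠ 0 := by positivity
      exact ⟨-((j + 1) * (4 * ((k : ℝ) - (j + 1))))⁻¹, by field_simp⟩
    have hcg : SmoothOffZero fun y => c * g y := (SmoothOffZero.const c).mul hg
    have hcgw := hgw.const_mul hg c
    have hterm := (hQ.pow (j + 1)).mul hcg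
    refine ⟨fun y => ft y + Qfun h y ^ (j + 1) * (c * g y), fun y => c * lap hInv g y,
      hft.add hterm, hftw.add hft hterm ?_,
      ⟨fun y => e y + Qfun h y ^ j * (c * g y), he.add ((hQ.pow j).mul hcg), fun x hx => ?_⟩,
      (SmoothOffZero.const c).mul (hg.lap hInv), ?_, fun x hx => ?_⟩
    · convert ((homog_Qfun h).pow hQ (j + 1)).mul (hQ.pow (j + 1)) hcg hcgw using 1
      push_cast
      ring
    · linear_combination hfe x hx
    · convert (hgw.lap hg hInv).const_mul (hg.lap hInv) c using 1
      push_cast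
      ring
    · rw [lap_add hInv hft hterm hx, lap_Qfun_pow_succ_mul hSymm hInvh hcg hcgw hx,
        lap_const_mul hInv c hg hx, hlap x hx]
      push_cast
      linear_combination Qfun h x ^ j * g x * hc

/-- existence of harmonic extensions, flat-model Proposition `harm`:
every smooth `f` homogeneous of weight `k − n/2` admits a smooth homogeneous extension
`f̃` with `f̃ − f = O(Q)` and `Δ f̃ = O(Q^{k−1})`. -/
theorem harmonic_extension_exists
    (n : ℕ) (hn : 1 ≤ n)
    (h hInv : Matrix (Fin (n + 2)) (Fin (n + 2)) ℝ)
    (hSymm : ∀ A B, h A B = h B A) (hInvh : h * hInv = 1)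
    (k : ℕ) (hk : 1 ≤ k)
    (f : (Fin (n + 2) → ℝ) → ℝ) (hf : SmoothOffZero f)
    (hhom : Homog ((k : ℝ) - (n : ℝ) / 2) f) :
    ∃ ft : (Fin (n + 2) → ℝ) → ℝ,
      SmoothOffZero ft ∧ Homog ((k : ℝ) - (n : ℝ) / 2) ft ∧
      BigOQ h 1 (fun y => ft y - f y) ∧
      BigOQ h (k - 1) (lap hInv ft) := by
  obtain ⟨ft, g, hft, hftw, hO, hg, _, hlap⟩ :=
    exists_extension_lap_eq_pow_mul hSymm hInvh hf hhom (k - 1) (by omega)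
  exact ⟨ft, hft, hftw, hO, g, hg, hlap⟩
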